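/- arXiv:2304.10917 — 2 statements merged into one kernel-verified Lean document; each statement's English description precedes it below -/
import Mathlib

section
/- Suppose λ ∈ 𝒜(n,L) satisfies A^P(λ) = λ for some P ≥ 1, and define the P-periodic bi-infinite sequence β : ℤ → ℕ by β_i = f_L(A^{(−i) mod P}(λ)). Then β is balanced: there exist an integer j and coprime integers q ≥ 0, p ≥ 1 such that β_{i+j} = ⌈q(i+1)/p⌉ − ⌈q i/p⌉ for all i ∈ ℤ. -/
/-- Total number of non-bank parts: `t(λ) = ∑_{m=1}^L f_m(λ)`.
A state `σ : ℕ → ℕ` encodes an Austrian partition by its bank deposit `σ 0`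
and its part-frequencies `σ m = f_m` for `1 ≤ m ≤ L`. -/
def austrianT (L : ℕ) (σ : ℕ → ℕ) : ℕ := ∑ m ∈ Finset.Icc 1 L, σ m

/-- The Austrian Solitaire map `A` on frequency encodings:
`f_m(A λ) = f_{m+1}(λ)` for `1 ≤ m ≤ L-1`, `f_L(A λ) = ⌊(λ₀ + t(λ))/L⌋`,
and bank deposit `(λ₀ + t(λ)) mod L`. -/
def austrianStep (L : ℕ) (σ : ℕ → ℕ) : ℕ → ℕ := fun m =>
  if m = 0 then (σ 0 + austrianT L σ) % L
  else if m = L then (σ 0 + austrianT L σ) / L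
  else if m < L then σ (m + 1)
  else 0

/-- `σ` encodes an Austrian partition of `n` with bank capacity `L`:
bank deposit `σ 0 < L`, no parts of size `> L`, and total value `n`. -/
def IsAustrian (n L : ℕ) (σ : ℕ → ℕ) : Prop :=
  σ 0 < L ∧ (∀ m, L < m → σ m = 0) ∧ σ 0 + ∑ m ∈ Finset.Icc 1 L, m * σ m = n

/-- Every integer sequence indexed by `ℤ` has a discrete antiderivative. -/
theorem exists_int_antideriv (f : ℤ → ℤ) : ∃ F : ℤ → ℤ, ∀ i, F (i + 1) - F i = f i := by
  refine ⟨fun i => ∑ j ∈ Finset.range i.toNat, f j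
    - ∑ j ∈ Finset.range (-i).toNat, f (-(j : ℤ) - 1), fun i => ?_⟩
  obtain ⟨k, rfl | rfl⟩ := i.eq_nat_or_neg
  · have h₁ : ((k : ℤ) + 1).toNat = k + 1 := by omega
    have h₂ : (-((k : ℤ) + 1)).toNat = 0 := by omega
    have h₃ : (-(k : ℤ)).toNat = 0 := by omega
    simp only [h₁, h₂, h₃, Int.toNat_natCast, Finset.sum_range_succ, Finset.sum_range_zero]
    ring
  · rcases k with _ | k
    · simp
    · have h₁ : (-((k + 1 : ℕ) : ℤ) + 1).toNat = 0 := by omega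
      have h₂ : (-(-((k + 1 : ℕ) : ℤ) + 1)).toNat = k := by omega
      have h₃ : (-((k + 1 : ℕ) : ℤ)).toNat = 0 := by omega
      have h₄ : (- -((k + 1 : ℕ) : ℤ)).toNat = k + 1 := by omega
      have h₅ : -((k + 1 : ℕ) : ℤ) = -(k : ℤ) - 1 := by push_cast; ring
      simp only [h₁, h₂, h₃, h₄, Finset.sum_range_succ, Finset.sum_range_zero]
      rw [h₅]
      ring

theorem sum_range_int_sub (F : ℤ → ℤ) (i : ℤ) (m : ℕ) :
    ∑ j ∈ Finset.range m, (F (i + j + 1) - F (i + j)) = F (i + m) - F i := by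
  have h := Finset.sum_range_sub (fun j : ℕ => F (i + j)) m
  simpa [add_assoc] using h

theorem apply_add_mul_of_drift {x : ℤ → ℤ} {P κ : ℤ} (hx : ∀ i, x (i + P) = x i + κ) (i k : ℤ) :
    x (i + P * k) = x i + κ * k := by
  induction k using Int.induction_on with
  | zero => simp
  | succ k ih =>
    rw [show i + P * ((k : ℤ) + 1) = i + P * k + P by ring, hx, ih]; ring
  | pred k ih =>
    have h := hx (i + P * (-(k : ℤ) - 1))
    rw [show i + P * (-(k : ℤ) - 1) + P = i + P * -k by ring, ih] at h
    linarith

theorem drift_of_periodic_increments {f F : ℤ → ℤ} {P : ℤ} (hf : ∀ i, f (i + P) = f i)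
    (hF : ∀ i, F (i + 1) - F i = f i) (i : ℤ) : F (i + P) = F i + (F P - F 0) := by
  have hstep : ∀ i, F (i + 1 + P) - F (i + 1) = F (i + P) - F i := fun i => by
    have h₁ := hF (i + P)
    rw [hf, ← hF i, show i + P + 1 = i + 1 + P by ring] at h₁
    linarith
  suffices h : F (i + P) - F i = F P - F 0 by linarith
  induction i using Int.induction_on with
  | zero => simp
  | succ k ih => rw [hstep, ih]
  | pred k ih =>
    have h₁ := hstep (-(k : ℤ) - 1)
    rw [sub_add_cancel] at h₁
    rw [← h₁, ih]

theorem exists_forall_le_of_int_periodic {f : ℤ → ℤ} {P : ℤ} (hP : 0 < P)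
    (hf : ∀ i, f (i + P) = f i) : ∃ i₀, ∀ i, f i₀ ≤ f i := by
  obtain ⟨i₀, -, h⟩ := Finset.exists_min_image (Finset.Ico 0 P) f ⟨0, by simpa using hP⟩
  refine ⟨i₀, fun i => ?_⟩
  have h₁ := h (i % P) (by
    simpa using ⟨Int.emod_nonneg i hP.ne', Int.emod_lt_of_pos i hP⟩)
  have h₂ := apply_add_mul_of_drift (κ := 0) (fun i => by simpa using hf i) (i % P) (i / P)
  rw [Int.emod_add_mul_ediv] at h₂
  linarith

/-- If a sequence with nonnegative drift can step down to a value only when a still smaller value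
occurs later, then it never steps down. -/
theorem le_succ_of_drift_nonneg {x : ℤ → ℤ} {P κ : ℤ} (hP : 0 < P) (hκ : 0 ≤ κ)
    (hx : ∀ i, x (i + P) = x i + κ) {L : ℕ}
    (h : ∀ i, x (i + 1) < x i → x (i + 1 + L) < x (i + 1)) (i : ℤ) : x i ≤ x (i + 1) := by
  obtain ⟨i₀, hi₀⟩ := exists_forall_le_of_int_periodic (f := fun i => x (i % P)) hP (by simp)
  have hmin : ∀ j, i₀ % P ≤ j → x (i₀ % P) ≤ x j := by
    intro j hj
    have h₁ := apply_add_mul_of_drift hx (j % P) (j / P)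
    rw [Int.emod_add_mul_ediv] at h₁
    have h₂ : 0 ≤ j / P :=
      Int.ediv_nonneg ((Int.emod_nonneg i₀ hP.ne').trans hj) hP.le
    have : x (i₀ % P) ≤ x (j % P) := hi₀ j
    have := mul_nonneg hκ h₂
    linarith
  have hback : ∀ d : ℕ, ∀ j, i₀ % P - d ≤ j → x (i₀ % P - d) ≤ x j := by
    intro d
    induction d with
    | zero => simpa using hmin
    | succ d ih =>
      have hs : x (i₀ % P - (d + 1 : ℕ)) ≤ x (i₀ % P - d) := by
        by_contra! hlt
        have e : i₀ % P - (d + 1 : ℕ) + 1 = i₀ % P - d := by push_cast; ring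
        have h₁ := h (i₀ % P - (d + 1 : ℕ)) (by rwa [e])
        rw [e] at h₁
        exact (ih _ (by omega)).not_gt h₁
      intro j hj
      rcases hj.eq_or_lt with rfl | hj
      · exact le_rfl
      · exact hs.trans (ih j (by push_cast at hj; omega))
  obtain ⟨k, hk⟩ : ∃ k : ℕ, i + P * -(k : ℤ) ≤ i₀ % P :=
    ⟨(i - i₀ % P).toNat, by nlinarith [Int.self_le_toNat (i - i₀ % P)]⟩
  have h₁ := hback (i₀ % P - (i + P * -(k : ℤ))).toNat (i + P * -(k : ℤ) + 1) (by omega)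
  rw [show i₀ % P - ((i₀ % P - (i + P * -(k : ℤ))).toNat : ℤ) = i + P * -(k : ℤ) by omega,
    show i + P * -(k : ℤ) + 1 = i + 1 + P * -(k : ℤ) by ring,
    apply_add_mul_of_drift hx, apply_add_mul_of_drift hx] at h₁
  linarith

/-- A periodic sequence in which each positive term precedes a window with positive sum and each
negative term precedes a window with negative sum has constant sign. -/
theorem nonneg_or_nonpos_of_window_sum {χ : ℤ → ℤ} {P : ℤ} (hP : 0 < P)
    (hχ : ∀ i, χ (i + P) = χ i) {L : ℕ}
    (hpos : ∀ i, 0 < χ i → 0 < ∑ j ∈ Finset.range L, χ (i + 1 + j))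
    (hneg : ∀ i, χ i < 0 → ∑ j ∈ Finset.range L, χ (i + 1 + j) < 0) :
    (∀ i, 0 ≤ χ i) ∨ (∀ i, χ i ≤ 0) := by
  obtain ⟨x, hx⟩ := exists_int_antideriv χ
  have hsum : ∀ i, ∑ j ∈ Finset.range L, χ (i + 1 + j) = x (i + 1 + L) - x (i + 1) := fun i => by
    simp only [← hx, sum_range_int_sub]
  have hdrift := drift_of_periodic_increments hχ hx
  rcases le_total 0 (x P - x 0) with hκ | hκ
  · left
    intro i
    have := le_succ_of_drift_nonneg (x := x) (L := L) hP hκ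
      hdrift (fun i hi => by
        have := hneg i (by linarith [hx i])
        rw [hsum] at this
        linarith) i
    linarith [hx i]
  · right
    intro i
    have := le_succ_of_drift_nonneg (x := fun i => -x i) (κ := -(x P - x 0)) (L := L) hP
      (by linarith) (fun i => by linarith [hdrift i]) (fun i hi => by
        have := hpos i (by linarith [hx i])
        rw [hsum] at this
        linarith) i
    linarith [hx i]

/-- If the window sums of a sequence with drift are confined to `L` consecutive integers, then its
increments over any fixed distance differ by at most one. -/
theorem increment_le_increment_add_one {C : ℤ → ℤ} {P Q n : ℤ} {L : ℕ} (hP : 0 < P)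
    (hC : ∀ i, C (i + P) = C i + Q)
    (hle : ∀ i, ∑ j ∈ Finset.range L, (C (i + 1 + j) - C i) ≤ n)
    (hlt : ∀ i, n < ∑ j ∈ Finset.range L, (C (i + 1 + j) - C i) + L) (a i k : ℤ) :
    C (i + a) - C i ≤ C (k + a) - C k + 1 := by
  by_contra! hcon
  set D : ℤ → ℤ := fun i => C (i + a) - C i with hD
  have hDP : ∀ i, D (i + P) = D i := fun i => by
    simp only [hD, add_right_comm i P a, hC]; ring
  obtain ⟨k₀, hk₀⟩ := exists_forall_le_of_int_periodic hP hDP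
  obtain ⟨i₀, hi₀⟩ := exists_forall_le_of_int_periodic (f := fun i => -D i) hP
    (fun i => by rw [hDP])
  have hgap : D k₀ + 2 ≤ D i₀ := by
    have h₁ := hk₀ k
    have h₂ := hi₀ i
    simp only [hD] at h₁ h₂ ⊢
    linarith
  have hsum : ∀ i, |∑ j ∈ Finset.range L, (D (i + 1 + j) - D i)| < L := fun i => by
    have e : ∑ j ∈ Finset.range L, (D (i + 1 + j) - D i)
        = ∑ j ∈ Finset.range L, (C (i + a + 1 + j) - C (i + a))
          - ∑ j ∈ Finset.range L, (C (i + 1 + j) - C i) := by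
      rw [← Finset.sum_sub_distrib]
      refine Finset.sum_congr rfl fun j _ => ?_
      simp only [hD]
      rw [show i + 1 + j + a = i + a + 1 + j by ring]
      ring
    rw [e, abs_lt]
    constructor <;> linarith [hle i, hlt i, hle (i + a), hlt (i + a)]
  have hmax : ∀ i, D i ≤ D i₀ := fun i => neg_le_neg_iff.1 (hi₀ i)
  clear_value D
  have key := nonneg_or_nonpos_of_window_sum (L := L)
    (χ := fun i => (if D i = D i₀ then 1 else 0) - (if D i = D k₀ then 1 else 0)) hP
    (fun i => by simp only [hDP]) (fun i hi => ?_) (fun i hi => ?_)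
  · rcases key with h | h
    · have := h k₀
      rw [if_neg (by omega), if_pos rfl] at this
      omega
    · have := h i₀
      rw [if_pos rfl, if_neg (by omega)] at this
      omega
  · have hi' : D i = D i₀ := by
      by_contra hne
      simp only [if_neg hne] at hi
      split_ifs at hi <;> omega
    have h₁ : ∑ j ∈ Finset.range L, (D (i + 1 + j) - D i + 1) ≤ ∑ j ∈ Finset.range L,
        ((if D (i + 1 + j) = D i₀ then 1 else 0) - (if D (i + 1 + j) = D k₀ then 1 else 0)) := by
      refine Finset.sum_le_sum fun j _ => ?_
      have := hmax (i + 1 + j)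
      split_ifs <;> omega
    rw [Finset.sum_add_distrib] at h₁
    simp only [Finset.sum_const, Finset.card_range, nsmul_eq_mul, mul_one] at h₁
    linarith [(abs_lt.1 (hsum i)).1]
  · have hi' : D i = D k₀ := by
      by_contra hne
      simp only [if_neg hne] at hi
      split_ifs at hi <;> omega
    have h₁ : ∑ j ∈ Finset.range L,
        ((if D (i + 1 + j) = D i₀ then 1 else 0) - (if D (i + 1 + j) = D k₀ then 1 else 0))
        ≤ ∑ j ∈ Finset.range L, (D (i + 1 + j) - D i - 1) := by
      refine Finset.sum_le_sum fun j _ => ?_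
      have := hk₀ (i + 1 + j)
      split_ifs <;> omega
    rw [Finset.sum_sub_distrib (fun j : ℕ => D (i + 1 + j) - D i) (fun _ => 1)] at h₁
    simp only [Finset.sum_const, Finset.card_range, nsmul_eq_mul, mul_one] at h₁
    linarith [(abs_lt.1 (hsum i)).2]

/-- A sequence with drift `Q` over the period `P` whose increments over any fixed distance differ
by at most one is, up to a shift, `i ↦ ⌈Q i / P⌉`. -/
theorem exists_shift_eq_ceil {C : ℤ → ℤ} {P : ℕ} {Q : ℤ} (hP : 0 < P)
    (hC : ∀ i, C (i + P) = C i + Q)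
    (hbal : ∀ a i k, C (i + a) - C i ≤ C (k + a) - C k + 1) :
    ∃ j, ∀ i : ℤ, C (i + j) = C j + ⌈(Q : ℚ) * i / P⌉ := by
  have hPz : (0 : ℤ) < P := by exact_mod_cast hP
  have hlt : ∀ a i, P * (C (i + a) - C i) < Q * a + P := by
    intro a i
    have h₁ : ∑ j ∈ Finset.range P, (C (i + a * j + a) - C (i + a * j)) = Q * a := by
      have h₂ := Finset.sum_range_sub (fun j : ℕ => C (i + a * j)) P
      have h₃ := apply_add_mul_of_drift hC i a
      rw [mul_comm (P : ℤ) a] at h₃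
      simp only [Nat.cast_add, Nat.cast_one, mul_add, mul_one, ← add_assoc, Nat.cast_zero,
        mul_zero, add_zero, h₃] at h₂
      rw [h₂]; ring
    have h₂ : ∑ _j ∈ Finset.range P, (C (i + a) - C i - 1)
        < ∑ j ∈ Finset.range P, (C (i + a * j + a) - C (i + a * j)) :=
      Finset.sum_lt_sum (fun j _ => by linarith [hbal a i (i + a * j)])
        ⟨0, Finset.mem_range.2 hP, by simp⟩
    rw [h₁] at h₂
    simp only [Finset.sum_const, Finset.card_range, nsmul_eq_mul] at h₂
    linarith
  obtain ⟨j, hj⟩ := exists_forall_le_of_int_periodic (f := fun i => P * C i - Q * i) hPz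
    (fun i => by simp only [hC]; ring)
  refine ⟨j, fun i => ?_⟩
  have h₁ := hj (i + j)
  have h₂ := hlt i j
  rw [add_comm j i] at h₂
  have hPq : (0 : ℚ) < P := by exact_mod_cast hP
  have e : ⌈(Q : ℚ) * i / P⌉ = C (i + j) - C j := by
    rw [Int.ceil_eq_iff, lt_div_iff₀ hPq, div_le_iff₀ hPq]
    constructor
    · have : (C (i + j) - C j - 1) * P < Q * i := by linarith
      exact_mod_cast this
    · have : Q * i ≤ (C (i + j) - C j) * P := by linarith
      exact_mod_cast this
  rw [e]; ring

theorem IsAustrian.austrianStep {n L : ℕ} {σ : ℕ → ℕ} (hL : 1 ≤ L) (h : IsAustrian n L σ) :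
    IsAustrian n L (austrianStep L σ) := by
  obtain ⟨L, rfl⟩ : ∃ l, L = l + 1 := ⟨L - 1, by omega⟩
  obtain ⟨-, -, h⟩ := h
  refine ⟨?_, fun m hm => ?_, ?_⟩
  · simpa [_root_.austrianStep] using Nat.mod_lt _ hL
  · simp [_root_.austrianStep, show m ≠ 0 by omega, show m ≠ L + 1 by omega,
      show ¬ m < L + 1 by omega]
  · have hIcc : ∀ f : ℕ → ℕ, ∑ m ∈ Finset.Icc 1 (L + 1), f m
        = ∑ m ∈ Finset.range (L + 1), f (m + 1) := fun f => by
      rw [Finset.range_eq_Ico, Finset.sum_Ico_add' f 0 (L + 1) 1]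
      rfl
    have hlow : ∑ m ∈ Finset.range L, (m + 1) * _root_.austrianStep (L + 1) σ (m + 1)
        = ∑ m ∈ Finset.range L, (m + 1) * σ (m + 1 + 1) := by
      refine Finset.sum_congr rfl fun m hm => ?_
      have := Finset.mem_range.1 hm
      simp [_root_.austrianStep, show m ≠ L by omega, this]
    rw [hIcc, Finset.sum_range_succ, hlow]
    have h₁ : ∑ m ∈ Finset.range (L + 1), (m + 1) * σ (m + 1)
        = ∑ m ∈ Finset.range L, (m + 1) * σ (m + 1 + 1) + austrianT (L + 1) σ := by
      rw [austrianT, hIcc]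
      simp only [add_mul, one_mul, Finset.sum_add_distrib]
      rw [Finset.sum_range_succ' (fun m => m * σ (m + 1))]
      simp [add_mul, Finset.sum_add_distrib]
    rw [hIcc, h₁] at h
    have h₂ := Nat.mod_add_div (σ 0 + austrianT (L + 1) σ) (L + 1)
    simp only [_root_.austrianStep, if_true, Nat.succ_ne_zero, if_false]
    omega

/-- The top frequencies of an orbit, read backwards in time, determine each of its partitions. -/
theorem austrian_orbit_apply {L : ℕ} {ρ : ℤ → ℕ → ℕ}
    (hρ : ∀ i, ρ i = austrianStep L (ρ (i + 1))) (d : ℕ) :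
    ∀ i, d < L → ρ i (L - d) = ρ (i + d) L := by
  induction d with
  | zero => simp
  | succ d ih =>
    intro i hd
    have h : ρ i (L - (d + 1)) = ρ (i + 1) (L - d) := by
      rw [hρ i, austrianStep, if_neg (by omega), if_neg (by omega), if_pos (by omega),
        show L - (d + 1) + 1 = L - d by omega]
    rw [h, ih (i + 1) (by omega)]
    congr 1
    push_cast
    ring

/-- An Austrian partition in a backward orbit has value given by the partial sums `C` of the top
frequencies. -/
theorem austrian_value_eq {n L : ℕ} {ρ : ℤ → ℕ → ℕ} (hρ : ∀ i, ρ i = austrianStep L (ρ (i + 1)))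
    (hA : ∀ i, IsAustrian n L (ρ i)) {C : ℤ → ℤ} (hC : ∀ i, C (i + 1) - C i = ρ i L) (i : ℤ) :
    (ρ i 0 : ℤ) + ∑ j ∈ Finset.range L, (C (i + 1 + j) - C i) = n := by
  have habel : ∀ m : ℕ, ∑ j ∈ Finset.range m, (C (i + 1 + j) - C i)
      = ∑ d ∈ Finset.range m, ((m : ℤ) - d) * (C (i + d + 1) - C (i + d)) := by
    intro m
    induction m with
    | zero => simp
    | succ m ih =>
      have h := sum_range_int_sub C i (m + 1)
      rw [Finset.sum_range_succ, ih]
      have e : ∀ d : ℕ, ((m + 1 : ℕ) - (d : ℤ)) * (C (i + d + 1) - C (i + d))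
          = ((m : ℤ) - d) * (C (i + d + 1) - C (i + d)) + (C (i + d + 1) - C (i + d)) := by
        intro d; push_cast; ring
      simp only [e]
      rw [Finset.sum_add_distrib, h, Finset.sum_range_succ (fun d : ℕ => ((m : ℤ) - d) * _)]
      rw [show i + 1 + (m : ℤ) = i + ((m + 1 : ℕ) : ℤ) by push_cast; ring]
      ring
  have hval : ∑ m ∈ Finset.Icc 1 L, m * ρ i m = ∑ d ∈ Finset.range L, (L - d) * ρ (i + d) L := by
    refine (Finset.sum_nbij' (fun d => L - d) (fun m => L - m) ?_ ?_ ?_ ?_ ?_).symm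
    · intro d hd; simp at hd ⊢; omega
    · intro d hd; simp at hd ⊢; omega
    · intro d hd; simp at hd ⊢; omega
    · intro d hd; simp at hd ⊢; omega
    · intro d hd
      rw [austrian_orbit_apply hρ d i (Finset.mem_range.1 hd)]
  obtain ⟨-, -, h⟩ := hA i
  rw [hval] at h
  rw [habel, ← h]
  push_cast
  congr 1
  refine Finset.sum_congr rfl fun d hd => ?_
  rw [hC, Nat.cast_sub (Finset.mem_range.1 hd).le]

/-- **Periodic partitions are balanced.**  If `λ ∈ 𝒜(n,L)` satisfies `A^P λ = λ`
with `P ≥ 1` and `β : ℤ → ℕ` is the `P`-periodic sequence `β_i = f_L(A^{(-i) mod P} λ)`,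
then `β` is balanced: some shift of `β` is the maximal balanced sequence
`γ_i = ⌈q(i+1)/p⌉ - ⌈q i/p⌉` for some coprime `q ≥ 0`, `p ≥ 1`. -/
theorem periodic_is_balanced (n L P : ℕ) (hL : 1 ≤ L) (hP : 1 ≤ P) (σ : ℕ → ℕ)
    (hσ : IsAustrian n L σ) (hper : (austrianStep L)^[P] σ = σ) :
    ∃ (j : ℤ) (q p : ℕ), 1 ≤ p ∧ Nat.Coprime q p ∧
      ∀ i : ℤ,
        ((((austrianStep L)^[((-(i + j)) % (P : ℤ)).toNat] σ) L : ℤ) =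
          ⌈(q : ℚ) * ((i : ℚ) + 1) / (p : ℚ)⌉ - ⌈(q : ℚ) * (i : ℚ) / (p : ℚ)⌉) := by
  have hPz : (0 : ℤ) < P := by exact_mod_cast hP
  set ρ : ℤ → ℕ → ℕ := fun i => (austrianStep L)^[(-i % (P : ℤ)).toNat] σ with hρdef
  have hA : ∀ i, IsAustrian n L (ρ i) := fun i => by
    simp only [hρdef]
    generalize (-i % (P : ℤ)).toNat = k
    induction k with
    | zero => exact hσ
    | succ k ih => rw [Function.iterate_succ_apply']; exact ih.austrianStep hL
  have hmod : ∀ k : ℕ, (austrianStep L)^[k % P] σ = (austrianStep L)^[k] σ := fun k =>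
    Function.IsPeriodicPt.iterate_mod_apply hper k
  have hρ : ∀ i, ρ i = austrianStep L (ρ (i + 1)) := fun i => by
    simp only [hρdef]
    rw [← Function.iterate_succ_apply' (austrianStep L), ← hmod (_ + 1)]
    congr 2
    zify
    rw [Int.toNat_of_nonneg (Int.emod_nonneg _ hPz.ne'),
      Int.toNat_of_nonneg (Int.emod_nonneg _ hPz.ne'), Int.emod_add_emod]
    congr 1
    ring
  have hρP : ∀ i, ρ (i + P) = ρ i := fun i => by
    simp only [hρdef]
    rw [show -(i + (P : ℤ)) = -i + P * (-1) by ring, Int.add_mul_emod_self_left]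
  obtain ⟨C, hC⟩ := exists_int_antideriv (fun i => (ρ i L : ℤ))
  obtain ⟨Q, hQ⟩ : ∃ Q : ℕ, C P - C 0 = Q := by
    refine ⟨∑ j ∈ Finset.range P, ρ j L, ?_⟩
    have h := sum_range_int_sub C 0 P
    simp only [hC, zero_add] at h
    push_cast
    exact h.symm
  have hdrift : ∀ i, C (i + P) = C i + Q := fun i => by
    rw [← hQ]
    exact drift_of_periodic_increments (fun i => by rw [hρP]) hC i
  have hval := austrian_value_eq hρ hA hC
  have hbal := increment_le_increment_add_one (n := n) (L := L) hPz hdrift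
    (fun i => by linarith [hval i, Int.natCast_nonneg (ρ i 0)])
    (fun i => by
      have : (ρ i 0 : ℤ) < L := by exact_mod_cast (hA i).1
      linarith [hval i])
  obtain ⟨j, hj⟩ := exists_shift_eq_ceil hP hdrift hbal
  have hg : 0 < Nat.gcd Q P := Nat.gcd_pos_of_pos_right _ hP
  have hPg : 0 < P / Nat.gcd Q P := Nat.div_pos (Nat.gcd_le_right _ hP) hg
  refine ⟨j, Q / Nat.gcd Q P, P / Nat.gcd Q P, hPg, Nat.coprime_div_gcd_div_gcd hg, fun i => ?_⟩
  have hred : ∀ y : ℚ, ((Q / Nat.gcd Q P : ℕ) : ℚ) * y / ((P / Nat.gcd Q P : ℕ) : ℚ)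
      = ((Q : ℤ) : ℚ) * y / P := fun y => by
    have hg' : (Nat.gcd Q P : ℚ) ≠ 0 := by exact_mod_cast hg.ne'
    have hP' : (P : ℚ) ≠ 0 := by exact_mod_cast hPz.ne'
    rw [Nat.cast_div (Nat.gcd_dvd_left _ _) hg', Nat.cast_div (Nat.gcd_dvd_right _ _) hg']
    push_cast
    field_simp
  have h₀ := hj i
  have h₁ := hj (i + 1)
  have h₂ := hC (i + j)
  rw [show i + j + 1 = i + 1 + j by ring, h₁, h₀] at h₂
  rw [hred, hred]
  push_cast at h₂ ⊢
  linarith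
end

section
/- Fix L ≥ 1. Suppose λ ∈ 𝒜(n,L) is periodic with minimal period p under A, and λ' ∈ 𝒜(n',L) is periodic with minimal period p' under A. Let q = ∑_{i=0}^{p−1} f_L(A^i(λ)) and q' = ∑_{i=0}^{p'−1} f_L(A^i(λ')). If q'/p' > q/p, then n' > n. -/
theorem sum_Icc_one_eq_sum_range (L : ℕ) (f : ℕ → ℕ) :
    ∑ m ∈ Finset.Icc 1 L, f m = ∑ m ∈ Finset.range L, f (m + 1) := by
  induction L with
  | zero => simp
  | succ L ih => rw [Finset.sum_Icc_succ_top (by omega), ih, Finset.sum_range_succ]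

theorem austrianStep_apply_of_lt {L m : ℕ} (σ : ℕ → ℕ) (hm : m + 1 < L) :
    austrianStep L σ (m + 1) = σ (m + 2) := by
  simp [austrianStep, hm, hm.ne]

theorem IsAustrian.iterate {n L : ℕ} {σ : ℕ → ℕ} (hL : 1 ≤ L) (h : IsAustrian n L σ) (k : ℕ) :
    IsAustrian n L ((_root_.austrianStep L)^[k] σ) := by
  induction k with
  | zero => exact h
  | succ k ih => rw [Function.iterate_succ_apply']; exact ih.austrianStep hL

theorem austrianStep_iterate_apply {L m : ℕ} (σ : ℕ → ℕ) (hm : m < L) (k : ℕ) :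
    (austrianStep L)^[k] σ (m + 1) = (austrianStep L)^[k + m] σ 1 := by
  induction m generalizing k with
  | zero => rfl
  | succ m ih =>
    rw [← austrianStep_apply_of_lt ((austrianStep L)^[k] σ) hm, ← Function.iterate_succ_apply' (austrianStep L),
      ih (by omega), Nat.succ_add, Nat.add_succ]

/-- Abel summation for linear weights. -/
theorem sum_linear_weight_add_sum_partialSums (a : ℕ → ℕ) (k L : ℕ) :
    ∑ m ∈ Finset.range L, (m + 1) * a (k + m) +
      ∑ j ∈ Finset.range L, ∑ i ∈ Finset.range (k + j), a i =
    L * ∑ i ∈ Finset.range (k + L), a i := by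
  induction L with
  | zero => simp
  | succ L ih =>
    rw [Finset.sum_range_succ, Finset.sum_range_succ _ L, ← add_assoc k L 1,
      Finset.sum_range_succ _ (k + L)]
    linarith

/-- The number of parts of size `1` met during the first `k` steps. -/
def austrianCount (L : ℕ) (σ : ℕ → ℕ) (k : ℕ) : ℕ :=
  ∑ i ∈ Finset.range k, (austrianStep L)^[i] σ 1

/-- The cumulative counts satisfy
`S (k + L) = ⌊(n + S k + ⋯ + S (k + L - 1)) / L⌋`, with the bank deposit as remainder. -/
theorem IsAustrian.count_recurrence {n L : ℕ} {σ : ℕ → ℕ} (hL : 1 ≤ L)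
    (h : IsAustrian n L σ) (k : ℕ) :
    (_root_.austrianStep L)^[k] σ 0 + L * austrianCount L σ (k + L) =
      n + ∑ j ∈ Finset.range L, austrianCount L σ (k + j) := by
  have hn := (h.iterate hL k).2.2
  have hsum : ∑ m ∈ Finset.range L, (m + 1) * (_root_.austrianStep L)^[k] σ (m + 1) =
      ∑ m ∈ Finset.range L, (m + 1) * (_root_.austrianStep L)^[k + m] σ 1 :=
    Finset.sum_congr rfl fun m hm => by
      rw [austrianStep_iterate_apply σ (Finset.mem_range.mp hm)]
  rw [sum_Icc_one_eq_sum_range, hsum] at hn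
  have habel := sum_linear_weight_add_sum_partialSums
    (fun i => (_root_.austrianStep L)^[i] σ 1) k L
  simp only [austrianCount]
  omega

theorem monotone_austrianCount (L : ℕ) (σ : ℕ → ℕ) : Monotone (austrianCount L σ) :=
  fun _ _ h => Finset.sum_le_sum_of_subset (Finset.range_subset_range.mpr h)

theorem austrianCount_le_add {L n n' : ℕ} {σ σ' : ℕ → ℕ} (hL : 1 ≤ L)
    (hσ : IsAustrian n L σ) (hσ' : IsAustrian n' L σ') (hn : n' ≤ n) (k : ℕ) :
    austrianCount L σ' k ≤ austrianCount L σ k + austrianCount L σ' L := by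
  induction k using Nat.strong_induction_on with
  | _ k ih =>
    rcases lt_or_ge k L with hk | hk
    · exact (monotone_austrianCount L σ' hk.le).trans (Nat.le_add_left _ _)
    · obtain ⟨k, rfl⟩ := Nat.exists_eq_add_of_le' hk
      have h := hσ.count_recurrence hL k
      have h' := hσ'.count_recurrence hL k
      have hb := (hσ.iterate hL k).1
      have hle : ∑ j ∈ Finset.range L, austrianCount L σ' (k + j) ≤
          ∑ j ∈ Finset.range L, austrianCount L σ (k + j) + L * austrianCount L σ' L := by
        calc _ ≤ ∑ j ∈ Finset.range L, (austrianCount L σ (k + j) + austrianCount L σ' L) :=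
              Finset.sum_le_sum fun j hj => ih _ (by have := Finset.mem_range.mp hj; omega)
          _ = _ := by simp [Finset.sum_add_distrib]
      refine Nat.lt_succ_iff.mp (Nat.lt_of_mul_lt_mul_left (a := L) ?_)
      rw [Nat.mul_succ, Nat.mul_add]
      omega

theorem austrianCount_periodic {L p : ℕ} {σ : ℕ → ℕ} (hL : 1 ≤ L)
    (hper : (austrianStep L)^[p] σ = σ) (N : ℕ) :
    austrianCount L σ (L - 1 + p * N) = austrianCount L σ (L - 1) +
      N * ∑ i ∈ Finset.range p, (austrianStep L)^[i] σ L := by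
  induction N with
  | zero => simp
  | succ N ih =>
    have hfix : (austrianStep L)^[p * N] σ = σ := by
      rw [Function.iterate_mul]
      exact Function.iterate_fixed hper N
    have hsum : ∑ i ∈ Finset.range p, (austrianStep L)^[L - 1 + p * N + i] σ 1 =
        ∑ i ∈ Finset.range p, (austrianStep L)^[i] σ L :=
      Finset.sum_congr rfl fun i _ => by
        have h := austrianStep_iterate_apply σ (m := L - 1) (L := L) (by omega) i
        rw [Nat.sub_add_cancel hL] at h
        rw [h, show L - 1 + p * N + i = (i + (L - 1)) + p * N by ring,
          Function.iterate_add_apply _ _ (p * N), hfix]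
    rw [Nat.mul_succ, ← add_assoc, austrianCount, Finset.sum_range_add, hsum, ← austrianCount,
      ih]
    ring

/-- If `λ ∈ 𝒜(n,L)` and `λ' ∈ 𝒜(n',L)` are periodic with minimal periods `p, p'`,
and `q = ∑_{i<p} f_L(A^i λ)`, `q' = ∑_{i<p'} f_L(A^i λ')` satisfy `q'/p' > q/p`,
then `n' > n`. -/
theorem austrian_ratio_mono (L n n' p p' : ℕ) (hL : 1 ≤ L)
    (σ σ' : ℕ → ℕ) (hσ : IsAustrian n L σ) (hσ' : IsAustrian n' L σ')
    (hp : 1 ≤ p) (hper : (austrianStep L)^[p] σ = σ)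
    (hmin : ∀ k, 1 ≤ k → k < p → (austrianStep L)^[k] σ ≠ σ)
    (hp' : 1 ≤ p') (hper' : (austrianStep L)^[p'] σ' = σ')
    (hmin' : ∀ k, 1 ≤ k → k < p' → (austrianStep L)^[k] σ' ≠ σ')
    (hlt : ((∑ i ∈ Finset.range p, ((austrianStep L)^[i] σ) L : ℕ) : ℚ) / (p : ℚ) <
        ((∑ i ∈ Finset.range p', ((austrianStep L)^[i] σ') L : ℕ) : ℚ) / (p' : ℚ)) :
    n < n' := by
  by_contra! hn
  rw [div_lt_div_iff₀ (by exact_mod_cast hp) (by exact_mod_cast hp')] at hlt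
  norm_cast at hlt
  set N := austrianCount L σ (L - 1) + austrianCount L σ' L + 1 with hN
  have h := austrianCount_le_add hL hσ hσ' hn (L - 1 + p * p' * N)
  rw [mul_assoc p p' N, austrianCount_periodic hL hper, mul_left_comm,
    austrianCount_periodic hL hper'] at h
  set q := ∑ i ∈ Finset.range p, (austrianStep L)^[i] σ L
  set q' := ∑ i ∈ Finset.range p', (austrianStep L)^[i] σ' L
  nlinarith [Nat.mul_le_mul_left N (Nat.succ_le_of_lt hlt)]
end
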